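/- Let g, ρ, d > 0 and let σ ≥ g ρ d²/3. Then the function f : (0,∞) → ℝ defined by f(x) = (g ρ + σ x²) tanh(d x)/x is strictly increasing on (0,∞). -/

import Mathlib

/-- A function on `ℝ` vanishing at `0` with positive derivative on `(0, ∞)` is positive there. -/
lemma pos_of_hasDerivAt_pos {f f' : ℝ → ℝ} (hf : ∀ t, HasDerivAt f (f' t) t) (h0 : f 0 = 0)
    (hf' : ∀ t, 0 < t → 0 < f' t) : ∀ t, 0 < t → 0 < f t := by
  have hmono : StrictMonoOn f (Set.Ici 0) := by
    refine strictMonoOn_of_deriv_pos (convex_Ici 0)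
      (fun t _ => (hf t).continuousAt.continuousWithinAt) fun t ht => ?_
    rw [interior_Ici, Set.mem_Ioi] at ht
    rw [(hf t).deriv]
    exact hf' t ht
  intro t ht
  simpa [h0] using hmono Set.self_mem_Ici ht.le ht

lemma sq_sub_twelve_mul_sinh_add_pos (t : ℝ) (ht : 0 < t) :
    0 < (t ^ 2 - 12) * Real.sinh t + 12 * t + t ^ 3 := by
  have hp (n : ℕ) (t : ℝ) := hasDerivAt_pow n t
  have h₃ : ∀ t : ℝ, 0 < t → 0 < 6 * t * Real.sinh t + (t ^ 2 - 6) * Real.cosh t + 6 := by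
    refine pos_of_hasDerivAt_pos (f' := fun t => 8 * t * Real.cosh t + t ^ 2 * Real.sinh t)
      (fun t => ?_) (by simp) fun t ht => ?_
    · refine HasDerivAt.congr_deriv (((((hasDerivAt_id t).const_mul 6).mul (Real.hasDerivAt_sinh t)).add
        (((hp 2 t).sub_const 6).mul (Real.hasDerivAt_cosh t))).add_const 6) ?_
      simp only [id]
      push_cast
      ring
    · have := Real.cosh_pos t
      have := Real.sinh_pos_iff.2 ht
      positivity
  have h₂ : ∀ t : ℝ, 0 < t → 0 < (t ^ 2 - 10) * Real.sinh t + 4 * t * Real.cosh t + 6 * t := by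
    refine pos_of_hasDerivAt_pos (fun t => ?_) (by simp) h₃
    refine HasDerivAt.congr_deriv ((((hp 2 t).sub_const 10).mul (Real.hasDerivAt_sinh t)).add
      (((hasDerivAt_id t).const_mul 4).mul (Real.hasDerivAt_cosh t)) |>.add
      ((hasDerivAt_id t).const_mul 6)) ?_
    simp only [id]
    push_cast
    ring
  have h₁ : ∀ t : ℝ, 0 < t →
      0 < 2 * t * Real.sinh t + (t ^ 2 - 12) * Real.cosh t + 12 + 3 * t ^ 2 := by
    refine pos_of_hasDerivAt_pos (fun t => ?_) (by simp) h₂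
    refine HasDerivAt.congr_deriv (((((hasDerivAt_id t).const_mul 2).mul (Real.hasDerivAt_sinh t)).add
      (((hp 2 t).sub_const 12).mul (Real.hasDerivAt_cosh t))).add_const 12 |>.add
      ((hp 2 t).const_mul 3)) ?_
    simp only [id]
    push_cast
    ring
  refine pos_of_hasDerivAt_pos (f := fun t => (t ^ 2 - 12) * Real.sinh t + 12 * t + t ^ 3)
    (fun t => ?_) (by simp) h₁ t ht
  refine HasDerivAt.congr_deriv ((((hp 2 t).sub_const 12).mul (Real.hasDerivAt_sinh t)).add
    ((hasDerivAt_id t).const_mul 12) |>.add (hp 3 t)) ?_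
  push_cast
  ring

/-- for `g, ρ, d > 0` and `σ ≥ gρd²/3`, the function
`f(x) = (gρ + σx²) tanh(dx)/x` is strictly increasing on `(0,∞)`. -/
theorem dispersion_function_strictMono
    (g ρ σ d : ℝ) (hg : 0 < g) (hρ : 0 < ρ) (hd : 0 < d)
    (hσ : g * ρ * d ^ 2 / 3 ≤ σ) :
    StrictMonoOn (fun x : ℝ => (g * ρ + σ * x ^ 2) * Real.tanh (d * x) / x)
      (Set.Ioi (0:ℝ)) := by
  have hderiv (x : ℝ) (hx : 0 < x) :
      HasDerivAt (fun x : ℝ => (g * ρ + σ * x ^ 2) * Real.tanh (d * x) / x)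
        ((g * ρ * (d * x - Real.sinh (d * x) * Real.cosh (d * x))
          + σ * x ^ 2 * (d * x + Real.sinh (d * x) * Real.cosh (d * x)))
          / (Real.cosh (d * x) * x) ^ 2) x := by
    have hc := (Real.cosh_pos (d * x)).ne'
    have hlin : HasDerivAt (fun x : ℝ => d * x) d x := by
      simpa using (hasDerivAt_id x).const_mul d
    simp only [Real.tanh_eq_sinh_div_cosh]
    refine HasDerivAt.congr_deriv (((((hasDerivAt_pow 2 x).const_mul σ).const_add (g * ρ)).mul
      (hlin.sinh.div hlin.cosh hc)).div (hasDerivAt_id x) hx.ne') ?_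
    have hs := Real.cosh_sq (d * x)
    simp only [Pi.mul_apply, Pi.div_apply]
    field_simp
    push_cast
    linear_combination (g * ρ * d * x + σ * x ^ 3 * d) * hs
  refine strictMonoOn_of_deriv_pos (convex_Ioi 0)
    (fun x hx => (hderiv x hx).continuousAt.continuousWithinAt) fun x hx => ?_
  rw [interior_Ioi, Set.mem_Ioi] at hx
  rw [(hderiv x hx).deriv]
  have hc := Real.cosh_pos (d * x)
  have hdx : 0 < d * x := by positivity
  have hs := Real.sinh_pos_iff.2 hdx
  have key := sq_sub_twelve_mul_sinh_add_pos (2 * (d * x)) (by positivity)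
  rw [Real.sinh_two_mul] at key
  refine div_pos ?_ (by positivity)
  have hle : g * ρ * d ^ 2 / 3 * (x ^ 2 * (d * x + Real.sinh (d * x) * Real.cosh (d * x)))
      ≤ σ * (x ^ 2 * (d * x + Real.sinh (d * x) * Real.cosh (d * x))) :=
    mul_le_mul_of_nonneg_right hσ (by positivity)
  have hpos := mul_pos (mul_pos hg hρ) key
  linarith
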